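/- Let (X,ℬ,m,T) be a measure preserving transformation with m(X) = ∞ and no absolutely continuous invariant probability measure. Then for any countable collection 𝒱 of measurable sets, each of positive finite m-measure, there exists a strictly increasing sequence (n_j) of natural numbers such that for all A, B ∈ 𝒱, m(A ∩ T^{-n_j}B) → 0 as j → ∞. -/

import Mathlib

open MeasureTheory Filter Topology
open scoped ENNReal

/-- A nonzero `L²` function fixed by the Koopman operator of `T` yields an absolutely continuous
invariant probability measure, namely the normalization of `|g|² m`. -/
theorem exists_acip_of_compMeasurePreserving_eq {X : Type*} [MeasurableSpace X] {m : Measure X}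
    {T : X → X} (hT : MeasurePreserving T m m) {g : Lp ℝ 2 m}
    (hg : Lp.compMeasurePreserving T hT g = g) (hg0 : g ≠ 0) :
    ∃ ν : Measure X, IsProbabilityMeasure ν ∧ ν ≪ m ∧ ν.map T = ν := by
  set h : X → ℝ≥0∞ := fun x => ‖g x‖ₑ ^ (2 : ℝ) with hh
  have hmeas : Measurable h := (Lp.stronglyMeasurable g).measurable.enorm.pow_const _
  have hinv : h ∘ T =ᵐ[m] h := by
    filter_upwards [Lp.coeFn_compMeasurePreserving g hT] with x hx
    rw [hg] at hx
    simp [hh, hx]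
  have htop : ∫⁻ x, h x ∂m ≠ ∞ := by
    have := lintegral_rpow_enorm_lt_top_of_eLpNorm_lt_top (p := 2) (by norm_num) (by norm_num)
      (Lp.eLpNorm_lt_top g)
    simpa [hh] using this.ne
  have hne : ∫⁻ x, h x ∂m ≠ 0 := by
    rw [Ne, lintegral_eq_zero_iff hmeas]
    refine fun h0 => hg0 ((Lp.eq_zero_iff_ae_eq_zero).2 ?_)
    filter_upwards [h0] with x hx
    simpa [hh] using hx
  refine ⟨(∫⁻ x, h x ∂m)⁻¹ • m.withDensity h, ⟨?_⟩,
    (withDensity_absolutelyContinuous m h).smul_left _, ?_⟩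
  · simp [ENNReal.inv_mul_cancel hne htop]
  · rw [Measure.map_smul]
    congr 1
    ext s hs
    rw [Measure.map_apply hT.measurable hs, withDensity_apply _ (hT.measurable hs),
      withDensity_apply _ hs, ← hT.setLIntegral_comp_preimage hs hmeas]
    exact lintegral_congr_ae (ae_restrict_of_ae (hinv.symm))

/-- Without an absolutely continuous invariant probability measure, the correlations of a set of
finite measure tend to zero on average. -/
theorem tendsto_average_measureReal_inter_preimage {X : Type*} [MeasurableSpace X] {m : Measure X}
    {T : X → X} (hT : MeasurePreserving T m m)
    (hnoacip : ¬ ∃ ν : Measure X, IsProbabilityMeasure ν ∧ ν ≪ m ∧ ν.map T = ν)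
    {D : Set X} (hD : MeasurableSet D) (hfin : m D ≠ ∞) :
    Tendsto (fun n : ℕ => (n⁻¹ : ℝ) * ∑ k ∈ Finset.range n, m.real (D ∩ T^[k] ⁻¹' D))
      atTop (𝓝 0) := by
  set U : Lp ℝ 2 m →L[ℝ] Lp ℝ 2 m :=
    (Lp.compMeasurePreservingₗᵢ ℝ T hT).toContinuousLinearMap with hU
  set f : Lp ℝ 2 m := indicatorConstLp 2 hD hfin 1
  have hbot : U.eqLocus (1 : Lp ℝ 2 m →L[ℝ] Lp ℝ 2 m) = ⊥ := by
    refine (Submodule.eq_bot_iff _).2 fun g hg => ?_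
    by_contra hg0
    exact hnoacip (exists_acip_of_compMeasurePreserving_eq hT hg hg0)
  have hlim := U.tendsto_birkhoffAverage_orthogonalProjection
    (LinearIsometry.norm_toContinuousLinearMap_le _) f
  have hzero : (((U.eqLocus (1 : Lp ℝ 2 m →L[ℝ] Lp ℝ 2 m)).orthogonalProjectionOnto f :
      U.eqLocus (1 : Lp ℝ 2 m →L[ℝ] Lp ℝ 2 m)) : Lp ℝ 2 m) = 0 := by
    rw [← Submodule.mem_bot ℝ, ← hbot]
    exact Subtype.prop _
  rw [hzero] at hlim
  have hinner := (tendsto_const_nhds (x := f)).inner (𝕜 := ℝ) hlim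
  rw [inner_zero_right] at hinner
  refine hinner.congr fun n => ?_
  rw [birkhoffAverage, birkhoffSum, real_inner_smul_right, inner_sum]
  congr 1
  refine Finset.sum_congr rfl fun k _ => ?_
  have hiter : U^[k] f = Lp.compMeasurePreserving T^[k] (hT.iterate k) f :=
    congrFun (Lp.compMeasurePreserving_iterate hT k) f
  rw [id, hiter, Lp.indicatorConstLp_compMeasurePreserving]
  exact L2.real_inner_indicatorConstLp_one_indicatorConstLp_one _ _ _ _

/-- A real sequence whose averages tend to zero is frequently smaller than any `ε > 0`. -/
theorem frequently_lt_of_tendsto_average_zero {a : ℕ → ℝ}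
    (ha : Tendsto (fun n : ℕ => (n⁻¹ : ℝ) * ∑ k ∈ Finset.range n, a k) atTop (𝓝 0))
    {ε : ℝ} (hε : 0 < ε) : ∃ᶠ n in atTop, a n < ε := by
  intro h
  have hmin : Tendsto (fun n => min (a n) ε) atTop (𝓝 ε) := by
    refine tendsto_const_nhds.congr' ?_
    filter_upwards [h] with n hn
    rw [min_eq_right (not_lt.1 hn)]
  refine hε.not_ge (le_of_tendsto_of_tendsto' hmin.cesaro ha fun n => ?_)
  gcongr
  exact min_le_left _ _

/-- Let `(X, ℬ, m, T)` be a measure preserving transformation with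
`m(X) = ∞` and no absolutely continuous invariant probability measure.  Then for every
countable collection `𝒱` of measurable sets of positive finite measure there is a strictly
increasing sequence `(n_j)` with `m(A ∩ T^{-n_j} B) → 0` for all `A, B ∈ 𝒱`. -/
theorem stmt_4 {X : Type*} [MeasurableSpace X] (m : Measure X)
    (T : X → X) (hT : MeasurePreserving T m m) (hinf : m Set.univ = ⊤)
    (hnoacip : ¬ ∃ ν : Measure X, IsProbabilityMeasure ν ∧ ν ≪ m ∧ ν.map T = ν)
    (𝒱 : Set (Set X)) (hcount : 𝒱.Countable) (hmeas : ∀ A ∈ 𝒱, MeasurableSet A)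
    (hpos : ∀ A ∈ 𝒱, 0 < m A) (hfin : ∀ A ∈ 𝒱, m A < ⊤) :
    ∃ n : ℕ → ℕ, StrictMono n ∧ ∀ A ∈ 𝒱, ∀ B ∈ 𝒱,
      Tendsto (fun j : ℕ => m (A ∩ T^[n j] ⁻¹' B)) atTop (𝓝 0) := by
  rcases 𝒱.eq_empty_or_nonempty with rfl | hne
  · exact ⟨id, strictMono_id, by simp⟩
  obtain ⟨V, rfl⟩ := hcount.exists_eq_range hne
  simp only [Set.forall_mem_range] at hmeas hpos hfin ⊢
  set D : ℕ → Set X := Set.accumulate V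
  have hD (k : ℕ) : MeasurableSet (D k) := 
    MeasurableSet.biUnion (Set.to_countable _) fun i _ => hmeas i
  have hDfin (k : ℕ) : m (D k) ≠ ∞ :=
    (measure_biUnion_lt_top (Set.finite_Iic k) fun i _ => hfin i).ne
  obtain ⟨n, hn, hlt⟩ := extraction_forall_of_frequently fun k =>
    frequently_lt_of_tendsto_average_zero
      (tendsto_average_measureReal_inter_preimage hT hnoacip (hD k) (hDfin k))
      (Nat.one_div_pos_of_nat (α := ℝ) (n := k))
  refine ⟨n, hn, fun i j => ?_⟩
  have hbound : Tendsto (fun k : ℕ => ENNReal.ofReal (1 / ((k : ℝ) + 1))) atTop (𝓝 0) := by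
    simpa using ENNReal.tendsto_ofReal (tendsto_one_div_add_atTop_nhds_zero_nat (𝕜 := ℝ))
  refine tendsto_of_tendsto_of_tendsto_of_le_of_le' tendsto_const_nhds hbound
    (Eventually.of_forall fun _ => zero_le) ?_
  filter_upwards [eventually_ge_atTop i, eventually_ge_atTop j] with k hi hj
  have hsub {l : ℕ} (hl : l ≤ k) : V l ⊆ D k := Set.subset_biUnion_of_mem (u := V) hl
  calc m (V i ∩ T^[n k] ⁻¹' V j)
      ≤ m (D k ∩ T^[n k] ⁻¹' D k) :=
        measure_mono (Set.inter_subset_inter (hsub hi) (Set.preimage_mono (hsub hj)))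
    _ = ENNReal.ofReal (m.real (D k ∩ T^[n k] ⁻¹' D k)) :=
        (ofReal_measureReal (measure_ne_top_of_subset Set.inter_subset_left (hDfin k))).symm
    _ ≤ ENNReal.ofReal (1 / ((k : ℝ) + 1)) := ENNReal.ofReal_le_ofReal (hlt k).le
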